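/- Let M = SM(U) be a loopless and coloopless Schubert matroid on [n] of rank r, and let B be a basis of M with i(B) = 0 and e(B) = 1. For every i ≥ 0, the number of admissible Delannoy paths P associated to SM(U) with B_P = B and exactly i diagonal steps equals the binomial coefficient C(α(B), i). -/

import Mathlib

open scoped Classical

namespace GPoly

/-- A step of a Delannoy path: east `+(1,0)`, north `+(0,1)` or diagonal `+(1,1)`. -/
inductive DStep : Type
  | east : DStep
  | north : DStep
  | diag : DStep
  deriving DecidableEq

/-- Horizontal displacement of a step. -/
def DStep.dx : DStep → ℕ
  | .east => 1
  | .north => 0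
  | .diag => 1

/-- Vertical displacement of a step. -/
def DStep.dy : DStep → ℕ
  | .east => 0
  | .north => 1
  | .diag => 1

/-- Position reached after the first `k` steps of `P`, starting at the point `s`. -/
def pathPos (s : ℕ × ℕ) (P : List DStep) (k : ℕ) : ℕ × ℕ :=
  (s.1 + ((P.take k).map DStep.dx).sum, s.2 + ((P.take k).map DStep.dy).sum)

/-- The Gale order: `U ≤ B` iff the increasing enumerations satisfy `u_ℓ ≤ b_ℓ`. -/
def galeLe {α : Type*} [LinearOrder α] (U B : Finset α) : Prop :=
  List.Forall₂ (· ≤ ·) (U.sort (· ≤ ·)) (B.sort (· ≤ ·))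

/-- Bases of the Schubert matroid `SM(U)` of rank `r` on `[n] = {1, …, n}`:
all `r`-subsets `B` of `[n]` with `U ≤ B` in the Gale order. -/
noncomputable def schubertBases (n r : ℕ) (U : Finset ℕ) : Finset (Finset ℕ) :=
  (Finset.Icc 1 n).powerset.filter fun B => B.card = r ∧ galeLe U B

/-- The point `p` lies weakly below the lattice path `path(U)`. -/
def belowPath (U : Finset ℕ) (p : ℕ × ℕ) : Prop :=
  p.2 ≤ (U ∩ Finset.Icc 1 (p.1 + p.2)).card

/-- `path(U)` traverses the vertical unit segment from `(x, y)` to `(x, y+1)`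
(by its north step number `x + y + 1`). -/
def uVertSeg (U : Finset ℕ) (x y : ℕ) : Prop :=
  x + y + 1 ∈ U ∧ (U ∩ Finset.Icc 1 (x + y + 1)).card = y + 1

/-- A Delannoy path associated to `SM(U)`: starts at `(1,1)`, ends at `(n-r, r)` and
stays weakly below `path(U)`. -/
def IsDelannoy (n r : ℕ) (U : Finset ℕ) (P : List DStep) : Prop :=
  pathPos (1, 1) P P.length = (n - r, r) ∧
    ∀ k ≤ P.length, belowPath U (pathPos (1, 1) P k)

/-- Admissible Delannoy path associated to `SM(U)`. -/
def IsAdmissible (n r : ℕ) (U : Finset ℕ) (P : List DStep) : Prop :=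
  IsDelannoy n r U P ∧
    ∀ (k : ℕ) (h : k < P.length),
      (P.get ⟨k, h⟩ = DStep.north →
        pathPos (1, 1) P (k + 1) = (n - r, r) ∨
          ¬ uVertSeg U (pathPos (1, 1) P k).1 (pathPos (1, 1) P k).2) ∧
      (P.get ⟨k, h⟩ = DStep.diag →
        belowPath U ((pathPos (1, 1) P k).1, (pathPos (1, 1) P k).2 + 1) ∧
          ¬ uVertSeg U (pathPos (1, 1) P k).1 (pathPos (1, 1) P k).2)

/-- Number of diagonal steps of a path. -/
def diagCount (P : List DStep) : ℕ := (P.filter (· = DStep.diag)).length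

/-- The set of indices (0-based) of the diagonal steps of `P`. -/
def diagIndices (P : List DStep) : Finset ℕ :=
  (Finset.range P.length).filter fun k => P.getD k DStep.east = DStep.diag

/-- Replace a diagonal step by a north step followed by an east step. -/
def expandNE : DStep → List DStep
  | DStep.diag => [DStep.north, DStep.east]
  | s => [s]

/-- Replace a diagonal step by an east step followed by a north step. -/
def expandEN : DStep → List DStep
  | DStep.diag => [DStep.east, DStep.north]
  | s => [s]

/-- The full lattice path of `B_P`: an east step, a north step, then the steps of `P`
with each diagonal step replaced by a north step immediately followed by an east step. -/
def fullPath (P : List DStep) : List DStep :=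
  DStep.east :: DStep.north :: (P.map expandNE).flatten

/-- The subset of `[n]` whose `path` is the given (diagonal-free) list of steps:
the set of (1-based) positions of the north steps. -/
def northSet (L : List DStep) : Finset ℕ :=
  ((Finset.range L.length).filter fun k => L.getD k DStep.east = DStep.north).image (· + 1)

/-- The basis `B_P` associated to a Delannoy path `P`. -/
def delannoyBasis (P : List DStep) : Finset ℕ := northSet (fullPath P)

/-! ### Matroid notions for a family of bases -/

/-- `S` is independent for the basis family `ℬ`: it is contained in some basis. -/
def famIndep (ℬ : Finset (Finset ℕ)) (S : Finset ℕ) : Prop := ∃ B ∈ ℬ, S ⊆ B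

/-- `C` is a circuit for the basis family `ℬ`: a minimal dependent set. -/
def famCircuit (ℬ : Finset (Finset ℕ)) (C : Finset ℕ) : Prop :=
  ¬ famIndep ℬ C ∧ ∀ C' ⊂ C, famIndep ℬ C'

/-- The dual basis family on the ground set `E`: complements of bases. -/
noncomputable def famDual (E : Finset ℕ) (ℬ : Finset (Finset ℕ)) : Finset (Finset ℕ) :=
  ℬ.image fun B => E \ B

/-- `e ∉ B` is externally active: `e` is the smallest element of the unique circuit
contained in `B ∪ {e}`. -/
def ExtActive (E : Finset ℕ) (ℬ : Finset (Finset ℕ)) (B : Finset ℕ) (e : ℕ) : Prop :=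
  e ∈ E ∧ e ∉ B ∧
    ∃ C, C ⊆ insert e B ∧ famCircuit ℬ C ∧ e ∈ C ∧ ∀ x ∈ C, e ≤ x

/-- `i ∈ B` is internally active: `i` is the smallest element of the unique cocircuit
contained in `(E ∖ B) ∪ {i}`. -/
def IntActive (E : Finset ℕ) (ℬ : Finset (Finset ℕ)) (B : Finset ℕ) (i : ℕ) : Prop :=
  i ∈ B ∧
    ∃ C, C ⊆ insert i (E \ B) ∧ famCircuit (famDual E ℬ) C ∧ i ∈ C ∧ ∀ x ∈ C, i ≤ x

/-- External activity `e(B)`. -/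
noncomputable def extAct (E : Finset ℕ) (ℬ : Finset (Finset ℕ)) (B : Finset ℕ) : ℕ :=
  (E.filter (ExtActive E ℬ B)).card

/-- Internal activity `i(B)`. -/
noncomputable def intAct (E : Finset ℕ) (ℬ : Finset (Finset ℕ)) (B : Finset ℕ) : ℕ :=
  (E.filter (IntActive E ℬ B)).card

/-- The statistic `α(B)`: the number of `i ∈ B` such that `B' = (B ∖ {i}) ∪ {i+1}`
is a basis with `e(B') = e(B)` and `i(B') = i(B)`. -/
noncomputable def alphaStat (E : Finset ℕ) (ℬ : Finset (Finset ℕ)) (B : Finset ℕ) : ℕ :=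
  (B.filter fun i =>
    insert (i + 1) (B.erase i) ∈ ℬ ∧
      extAct E ℬ (insert (i + 1) (B.erase i)) = extAct E ℬ B ∧
      intAct E ℬ (insert (i + 1) (B.erase i)) = intAct E ℬ B).card

/-- The rank function determined by a family of bases. -/
noncomputable def famRank (ℬ : Finset (Finset ℕ)) (A : Finset ℕ) : ℕ :=
  ℬ.sup fun B => (A ∩ B).card

/-- The β-invariant: `β(M) = (−1)^{rk(E)} Σ_{A ⊆ E} (−1)^{|A|} rk(A)`. -/
noncomputable def betaInv (E : Finset ℕ) (ℬ : Finset (Finset ℕ)) : ℤ :=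
  (-1) ^ famRank ℬ E * ∑ A ∈ E.powerset, (-1) ^ A.card * (famRank ℬ A : ℤ)

/-- `ℬ` is the collection of bases of a matroid with ground set `E`:
it is a nonempty family of subsets of `E` satisfying the basis exchange property. -/
def IsBasisFamily (E : Finset ℕ) (ℬ : Finset (Finset ℕ)) : Prop :=
  ℬ.Nonempty ∧ (∀ B ∈ ℬ, B ⊆ E) ∧
    ∀ B₁ ∈ ℬ, ∀ B₂ ∈ ℬ, ∀ x ∈ B₁ \ B₂, ∃ y ∈ B₂ \ B₁, insert y (B₁.erase x) ∈ ℬ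

/-- Two elements lie in a common component: they are equal or in a common circuit. -/
def connRel (ℬ : Finset (Finset ℕ)) (e f : ℕ) : Prop :=
  e = f ∨ ∃ C, famCircuit ℬ C ∧ e ∈ C ∧ f ∈ C

/-- The number of connected components of the matroid with bases `ℬ` on `E`. -/
noncomputable def numComponents (E : Finset ℕ) (ℬ : Finset (Finset ℕ)) : ℕ :=
  Set.ncard {S : Set ℕ | ∃ e ∈ E, S = {f | f ∈ E ∧ Relation.EqvGen (connRel ℬ) e f}}

/-- The matroid with bases `ℬ` on ground set `E` is connected. -/
def IsConnectedFam (E : Finset ℕ) (ℬ : Finset (Finset ℕ)) : Prop :=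
  E.Nonempty ∧ ∀ e ∈ E, ∀ f ∈ E, Relation.EqvGen (connRel ℬ) e f

/-- Series-parallel matroid: isomorphic to `U_{0,1}` or `U_{1,1}`
(a single loop or a single coloop), or connected with β-invariant `1`. -/
def IsSeriesParallel (E : Finset ℕ) (ℬ : Finset (Finset ℕ)) : Prop :=
  (E.card = 1 ∧ (ℬ = {∅} ∨ ℬ = {E})) ∨ (IsConnectedFam E ℬ ∧ betaInv E ℬ = 1)

/-- The bases of the restriction of the matroid with bases `ℬ` to the set `F`:
the maximal intersections of bases with `F`. -/
noncomputable def famRestrict (ℬ : Finset (Finset ℕ)) (F : Finset ℕ) : Finset (Finset ℕ) :=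
  (ℬ.image (· ∩ F)).filter fun S => ∀ T ∈ ℬ.image (· ∩ F), S ⊆ T → S = T

/-- The matroid with bases `ℬ` on `E` is a direct sum of series-parallel matroids. -/
def IsDirectSumOfSeriesParallel (E : Finset ℕ) (ℬ : Finset (Finset ℕ)) : Prop :=
  ∃ parts : Finset (Finset ℕ),
    (↑parts : Set (Finset ℕ)).PairwiseDisjoint id ∧
    parts.sup id = E ∧
    (∀ S ∈ parts, IsSeriesParallel S (famRestrict ℬ S)) ∧
    ℬ = E.powerset.filter fun B => ∀ S ∈ parts, B ∩ S ∈ famRestrict ℬ S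

/-! ### Base polytopes -/

/-- The indicator vector of `B ⊆ E`, as a point of `ℝ^E`. -/
noncomputable def basisVector (E : Finset ℕ) (B : Finset ℕ) : ↑E → ℝ :=
  fun e => if (e : ℕ) ∈ B then 1 else 0

/-- The base polytope of the matroid with bases `ℬ` on `E`:
the convex hull in `ℝ^E` of the indicator vectors of the bases. -/
noncomputable def basePolytope (E : Finset ℕ) (ℬ : Finset (Finset ℕ)) : Set (↑E → ℝ) :=
  convexHull ℝ (basisVector E '' (↑ℬ : Set (Finset ℕ)))

/-- The indicator function `ℝ^E → ℤ` of the base polytope. -/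
noncomputable def polyInd (E : Finset ℕ) (ℬ : Finset (Finset ℕ)) : (↑E → ℝ) → ℤ :=
  fun x => if x ∈ basePolytope E ℬ then 1 else 0

/-- The indicator function `ℝ^E → ℤ` of the relative interior of the base polytope. -/
noncomputable def relintInd (E : Finset ℕ) (ℬ : Finset (Finset ℕ)) : (↑E → ℝ) → ℤ :=
  fun x => if x ∈ intrinsicInterior ℝ (basePolytope E ℬ) then 1 else 0

/-! ### Cyclic flats and the cyclic chain lattice -/

/-- `F` is a flat of the matroid with bases `ℬ` on `E`. -/
def IsFlat (E : Finset ℕ) (ℬ : Finset (Finset ℕ)) (F : Finset ℕ) : Prop :=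
  F ⊆ E ∧ ∀ e ∈ E, famRank ℬ (insert e F) = famRank ℬ F → e ∈ F

/-- `F` is a cyclic flat: a flat whose restriction has no coloops. -/
def IsCyclicFlat (E : Finset ℕ) (ℬ : Finset (Finset ℕ)) (F : Finset ℕ) : Prop :=
  IsFlat E ℬ F ∧ ∀ e ∈ F, ¬ (∀ S ∈ famRestrict ℬ F, e ∈ S)

/-- The set of cyclic flats. -/
noncomputable def cyclicFlats (E : Finset ℕ) (ℬ : Finset (Finset ℕ)) : Finset (Finset ℕ) :=
  E.powerset.filter (IsCyclicFlat E ℬ)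

/-- A chain of cyclic flats containing the minimum and maximum of the lattice of
cyclic flats; these are the elements (other than the top `1̂`) of the cyclic
chain lattice. -/
def IsCyclicChain (E : Finset ℕ) (ℬ : Finset (Finset ℕ)) (C : Finset (Finset ℕ)) : Prop :=
  ↑C ⊆ (cyclicFlats E ℬ : Set (Finset ℕ)) ∧ IsChain (· ⊆ ·) (↑C : Set (Finset ℕ)) ∧
    (∃ F ∈ C, ∀ G ∈ cyclicFlats E ℬ, F ⊆ G) ∧
    (∃ F ∈ C, ∀ G ∈ cyclicFlats E ℬ, G ⊆ F)

/-- The set of chains of cyclic flats containing the minimum and the maximum. -/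
noncomputable def cyclicChains (E : Finset ℕ) (ℬ : Finset (Finset ℕ)) :
    Finset (Finset (Finset ℕ)) :=
  (cyclicFlats E ℬ).powerset.filter (IsCyclicChain E ℬ)

/-- The rank function `A ↦ min_{Z ∈ C} (rk_M(Z) + |A ∖ Z|)` associated to a chain `C`. -/
noncomputable def chainRank (ℬ : Finset (Finset ℕ)) (C : Finset (Finset ℕ))
    (A : Finset ℕ) : ℕ :=
  if h : C.Nonempty then C.inf' h fun Z => famRank ℬ Z + (A \ Z).card else A.card

/-- The bases of the matroid on `E` with rank function `rk`:
the subsets `B ⊆ E` with `rk B = |B| = rk E`. -/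
noncomputable def basesOfRank (E : Finset ℕ) (rk : Finset ℕ → ℕ) : Finset (Finset ℕ) :=
  E.powerset.filter fun B => rk B = B.card ∧ rk B = rk E

/-- The bases of the Schubert matroid `S_C` associated to a chain `C` of cyclic flats. -/
noncomputable def chainSchubert (E : Finset ℕ) (ℬ : Finset (Finset ℕ))
    (C : Finset (Finset ℕ)) : Finset (Finset ℕ) :=
  basesOfRank E (chainRank ℬ C)

/-- The point reached by `path(S)` after `k` steps. -/
def pathPoint (S : Finset ℕ) (k : ℕ) : ℕ × ℕ :=
  (k - (S ∩ Finset.Icc 1 k).card, (S ∩ Finset.Icc 1 k).card)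


/-! ### Helper material for the proof -/

def cnt (B : Finset ℕ) (k : ℕ) : ℕ := (B ∩ Finset.Icc 1 k).card

theorem cnt_succ (B : Finset ℕ) (k : ℕ) :
    cnt B (k + 1) = cnt B k + (if k + 1 ∈ B then 1 else 0) := by
  unfold cnt
  rw [← Finset.insert_Icc_right_eq_Icc_add_one (by omega)]
  split_ifs with h
  · rw [Finset.inter_insert_of_mem h, Finset.card_insert_of_notMem (by simp)]
  · rw [Finset.inter_insert_of_notMem h]; rfl

theorem cnt_le_add (B : Finset ℕ) (k d : ℕ) : cnt B (k + d) ≤ cnt B k + d := by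
  induction d with
  | zero => simp
  | succ d ih => rw [← add_assoc, cnt_succ]; split_ifs <;> omega

theorem cnt_eq_add (B : Finset ℕ) (k d : ℕ) (h : ∀ x, k < x → x ≤ k + d → x ∈ B) :
    cnt B (k + d) = cnt B k + d := by
  induction d with
  | zero => simp
  | succ d ih =>
    rw [← add_assoc, cnt_succ, if_pos (h _ (by omega) (by omega)),
      ih (fun x h1 h2 => h x h1 (by omega))]
    omega

theorem cnt_top {n : ℕ} {B : Finset ℕ} (hB : B ⊆ Finset.Icc 1 n) : cnt B n = B.card := by
  unfold cnt
  rw [Finset.inter_eq_left.mpr hB]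

theorem cnt_top' {n k : ℕ} {B : Finset ℕ} (hB : B ⊆ Finset.Icc 1 n) (hk : n ≤ k) :
    cnt B k = B.card :=
  cnt_top (hB.trans (Finset.Icc_subset_Icc_right hk))

theorem cnt_swap {B : Finset ℕ} {a c : ℕ} (ha : a ∈ B) (hc : c ∉ B) (ha1 : 1 ≤ a)
    (hc1 : 1 ≤ c) (k : ℕ) :
    cnt (insert c (B.erase a)) k + (if a ≤ k then 1 else 0)
      = cnt B k + (if c ≤ k then 1 else 0) := by
  have hac : a ≠ c := fun h => hc (h ▸ ha)
  induction k with
  | zero =>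
    rw [if_neg (by omega), if_neg (by omega)]
    simp [cnt]
  | succ k ih =>
    rw [cnt_succ, cnt_succ]
    simp only [Finset.mem_insert, Finset.mem_erase]
    by_cases h1 : k + 1 = a
    · subst h1
      simp_all
      split_ifs at * <;> omega
    · by_cases h2 : k + 1 = c
      · subst h2
        simp_all
        split_ifs at * <;> omega
      · have e1 : (a ≤ k + 1) ↔ a ≤ k := by omega
        have e2 : (c ≤ k + 1) ↔ c ≤ k := by omega
        simp only [e1, e2, h1, h2, ne_eq, not_false_eq_true, true_and, false_or]
        omega

/-! Gale order via counting -/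

theorem forall2_count {l1 l2 : List ℕ} (h : List.Forall₂ (· ≤ ·) l1 l2) (k : ℕ) :
    l2.countP (fun x => decide (x ≤ k)) ≤ l1.countP (fun x => decide (x ≤ k)) := by
  induction h with
  | nil => simp
  | cons hab _ ih =>
    rw [List.countP_cons, List.countP_cons]
    simp only [decide_eq_true_eq]
    split_ifs <;> omega

theorem count_forall2 (l1 l2 : List ℕ) (h1 : l1.Pairwise (· ≤ ·)) (h2 : l2.Pairwise (· ≤ ·))
    (hlen : l1.length = l2.length)
    (h : ∀ k, l2.countP (fun x => decide (x ≤ k)) ≤ l1.countP (fun x => decide (x ≤ k))) :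
    List.Forall₂ (· ≤ ·) l1 l2 := by
  induction l1 generalizing l2 with
  | nil =>
    cases l2 with
    | nil => exact .nil
    | cons b l2 => simp at hlen
  | cons a l1 ih =>
    cases l2 with
    | nil => simp at hlen
    | cons b l2 =>
      rw [List.pairwise_cons] at h1 h2
      have hab : a ≤ b := by
        have h3 := h b
        rw [List.countP_cons] at h3
        simp only [le_refl, decide_true, if_true] at h3
        have h4 : 0 < (a :: l1).countP (fun x => decide (x ≤ b)) := by omega
        rw [List.countP_pos_iff] at h4
        obtain ⟨x, hx, hxb⟩ := h4
        simp only [decide_eq_true_eq] at hxb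
        rcases List.mem_cons.mp hx with rfl | hx
        · exact hxb
        · exact (h1.1 x hx).trans hxb
      refine .cons hab (ih l2 h1.2 h2.2 (by simpa using hlen) ?_)
      intro k
      by_cases hk : b ≤ k
      · have h3 := h k
        rw [List.countP_cons, List.countP_cons] at h3
        simp only [decide_eq_true_eq, hk, hab.trans hk, if_true] at h3
        omega
      · have : l2.countP (fun x => decide (x ≤ k)) = 0 := by
          rw [List.countP_eq_zero]
          intro x hx
          have := h2.1 x hx
          simp only [decide_eq_true_eq]
          omega
        omega

theorem cnt_eq_countP {n : ℕ} {B : Finset ℕ} (hB : B ⊆ Finset.Icc 1 n) (k : ℕ) :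
    (B.sort (· ≤ ·)).countP (fun x => decide (x ≤ k)) = cnt B k := by
  have h1 : (B.sort (· ≤ ·)).countP (fun x => decide (x ≤ k))
      = ((B.sort (· ≤ ·) : List ℕ) : Multiset ℕ).countP (fun x => x ≤ k) := by
    rw [Multiset.coe_countP]
  rw [h1, Finset.sort_eq, Multiset.countP_eq_card_filter]
  unfold cnt
  change (B.filter (fun x => x ≤ k)).card = _
  congr 1
  ext x
  simp only [Finset.mem_filter, Finset.mem_inter, Finset.mem_Icc]
  constructor
  · rintro ⟨h, h'⟩
    exact ⟨h, (Finset.mem_Icc.mp (hB h)).1, h'⟩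
  · rintro ⟨h, _, h'⟩
    exact ⟨h, h'⟩

theorem mem_bases {n r : ℕ} {U : Finset ℕ} (hU : U ⊆ Finset.Icc 1 n) (hr : U.card = r)
    (B : Finset ℕ) :
    B ∈ schubertBases n r U ↔ B ⊆ Finset.Icc 1 n ∧ B.card = r ∧ ∀ k, cnt B k ≤ cnt U k := by
  unfold schubertBases
  rw [Finset.mem_filter, Finset.mem_powerset]
  refine and_congr_right fun hB => and_congr_right fun hc => ?_
  unfold galeLe
  constructor
  · intro h k
    rw [← cnt_eq_countP hB, ← cnt_eq_countP hU]
    exact forall2_count h k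
  · intro h
    refine count_forall2 _ _ (Finset.pairwise_sort _ _) (Finset.pairwise_sort _ _)
      (by simp [hc, hr]) ?_
    intro k
    rw [cnt_eq_countP hB, cnt_eq_countP hU]
    exact h k

/-! Activities -/

theorem exists_circuit (F : Finset (Finset ℕ)) (D : Finset ℕ) (h : ¬ famIndep F D) :
    ∃ C, C ⊆ D ∧ famCircuit F C := by
  induction D using Finset.strongInduction with
  | H D ih =>
    by_cases h' : ∀ C' ⊂ D, famIndep F C'
    · exact ⟨D, subset_rfl, h, h'⟩
    · push Not at h'
      obtain ⟨C', h1, h2⟩ := h'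
      obtain ⟨C, h3, h4⟩ := ih C' h1 h2
      exact ⟨C, h3.trans h1.1, h4⟩

theorem swap_up {n r : ℕ} {U : Finset ℕ} (hU : U ⊆ Finset.Icc 1 n) (hr : U.card = r)
    {B : Finset ℕ} (hB : B ∈ schubertBases n r U) {a c : ℕ} (ha : a ∈ B) (hc : c ∉ B)
    (hac : a < c) (hcn : c ≤ n) : insert c (B.erase a) ∈ schubertBases n r U := by
  rw [mem_bases hU hr] at hB ⊢
  obtain ⟨h1, h2, h3⟩ := hB
  have ha1 := (Finset.mem_Icc.mp (h1 ha)).1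
  refine ⟨?_, ?_, ?_⟩
  · intro x hx
    rcases Finset.mem_insert.mp hx with rfl | hx
    · exact Finset.mem_Icc.mpr ⟨by omega, hcn⟩
    · exact h1 (Finset.mem_of_mem_erase hx)
  · rw [Finset.card_insert_of_notMem (by simp [hc]), Finset.card_erase_of_mem ha]
    have := Finset.card_pos.mpr ⟨a, ha⟩
    omega
  · intro k
    have h4 := cnt_swap ha hc ha1 (by omega) k
    have := h3 k
    split_ifs at h4 <;> omega

theorem extActive_iff {n r : ℕ} {U : Finset ℕ} (hU : U ⊆ Finset.Icc 1 n) (hr : U.card = r)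
    {B : Finset ℕ} (hB : B ∈ schubertBases n r U) (e : ℕ) :
    ExtActive (Finset.Icc 1 n) (schubertBases n r U) B e
      ↔ e ∈ Finset.Icc 1 n ∧ ∀ b ∈ B, e < b := by
  constructor
  · rintro ⟨h1, h2, C, h3, h4, h5, h6⟩
    refine ⟨h1, fun b hb => ?_⟩
    by_contra hlt
    have hbe : b < e := by
      rcases Nat.lt_or_ge b e with h | h
      · exact h
      · have : b = e := by omega
        exact absurd (this ▸ hb) h2
    refine h4.1 ⟨_, swap_up hU hr hB hb h2 hbe (Finset.mem_Icc.mp h1).2, ?_⟩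
    intro x hx
    have h7 := h6 x hx
    rcases Finset.mem_insert.mp (h3 hx) with rfl | h8
    · simp
    · refine Finset.mem_insert_of_mem (Finset.mem_erase.mpr ⟨by omega, h8⟩)
  · rintro ⟨h1, h2⟩
    have h3 : e ∉ B := fun h => lt_irrefl _ (h2 e h)
    have h4 : ¬ famIndep (schubertBases n r U) (insert e B) := by
      rintro ⟨B', h5, h6⟩
      have h7 := Finset.card_le_card h6
      rw [Finset.card_insert_of_notMem h3] at h7
      have h8 := ((mem_bases hU hr _).mp h5).2.1
      have h9 := ((mem_bases hU hr _).mp hB).2.1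
      omega
    obtain ⟨C, h5, h6⟩ := exists_circuit _ _ h4
    refine ⟨h1, h3, C, h5, h6, ?_, ?_⟩
    · by_contra h7
      exact h6.1 ⟨B, hB, (Finset.subset_insert_iff_of_notMem h7).mp h5⟩
    · intro x hx
      rcases Finset.mem_insert.mp (h5 hx) with rfl | h8
      · exact le_rfl
      · exact (h2 x h8).le

theorem extAct_one_iff {n r : ℕ} {U : Finset ℕ} (hU : U ⊆ Finset.Icc 1 n) (hr : U.card = r)
    {B : Finset ℕ} (hB : B ∈ schubertBases n r U) (hne : B.Nonempty) :
    extAct (Finset.Icc 1 n) (schubertBases n r U) B = 1 ↔ 1 ∉ B ∧ 2 ∈ B := by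
  have hsub := ((mem_bases hU hr _).mp hB).1
  unfold extAct
  have hmem : ∀ e, e ∈ (Finset.Icc 1 n).filter
      (ExtActive (Finset.Icc 1 n) (schubertBases n r U) B) ↔
      e ∈ Finset.Icc 1 n ∧ ∀ b ∈ B, e < b := by
    intro e
    rw [Finset.mem_filter, extActive_iff hU hr hB]
    tauto
  rw [Finset.card_eq_one]
  constructor
  · rintro ⟨a, ha⟩
    simp only [ha, Finset.mem_singleton] at hmem
    obtain ⟨h1, h2⟩ := (hmem a).mp rfl
    rw [Finset.mem_Icc] at h1
    have h1B : 1 ∉ B := fun h => by have := h2 1 h; omega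
    refine ⟨h1B, ?_⟩
    by_contra h2B
    have hb : ∀ b ∈ B, 2 < b := by
      intro b hb
      have h5 := Finset.mem_Icc.mp (hsub hb)
      rcases (by omega : b = 1 ∨ b = 2 ∨ 2 < b) with rfl | rfl | h
      · exact absurd hb h1B
      · exact absurd hb h2B
      · exact h
    obtain ⟨b, hbB⟩ := hne
    have h5 := Finset.mem_Icc.mp (hsub hbB)
    have h6 := hb b hbB
    have e1 := (hmem 1).mpr ⟨Finset.mem_Icc.mpr ⟨le_rfl, by omega⟩,
      fun b hb' => by have := hb b hb'; omega⟩
    have e2 := (hmem 2).mpr ⟨Finset.mem_Icc.mpr ⟨by omega, by omega⟩, hb⟩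
    omega
  · rintro ⟨h1, h2⟩
    refine ⟨1, ?_⟩
    ext e
    rw [hmem, Finset.mem_singleton, Finset.mem_Icc]
    constructor
    · rintro ⟨h3, h4⟩
      have := h4 2 h2
      omega
    · rintro rfl
      have h5 := Finset.mem_Icc.mp (hsub h2)
      refine ⟨⟨le_rfl, by omega⟩, fun b hb => ?_⟩
      have h6 := Finset.mem_Icc.mp (hsub hb)
      have : b ≠ 1 := fun h => h1 (h ▸ hb)
      omega

theorem card_split (B : Finset ℕ) (m : ℕ) (h : ∀ x ∈ B, 1 ≤ x) :
    B.card = cnt B m + (B.filter (fun x => m < x)).card := by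
  unfold cnt
  rw [← Finset.card_filter_add_card_filter_not (s := B) (fun x => m < x), add_comm]
  congr 2
  ext x
  simp only [Finset.mem_filter, Finset.mem_inter, Finset.mem_Icc, not_lt]
  exact ⟨fun hx => ⟨hx.1, h x hx.1, hx.2⟩, fun hx => ⟨hx.1, hx.2.2⟩⟩

theorem intActive_iff {n r : ℕ} {U : Finset ℕ} (hU : U ⊆ Finset.Icc 1 n) (hr : U.card = r)
    {B : Finset ℕ} (hB : B ∈ schubertBases n r U) (i : ℕ) (hi : i + 1 ∈ B) :
    IntActive (Finset.Icc 1 n) (schubertBases n r U) B (i + 1) ↔ cnt B i = cnt U i := by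
  have hB' := hB
  rw [mem_bases hU hr] at hB'
  obtain ⟨h1, h2, h3⟩ := hB'
  have hin := Finset.mem_Icc.mp (h1 hi)
  constructor
  · rintro ⟨-, C, hC, hcirc, hiC, hmin⟩
    by_contra hne
    have hlt : cnt B i < cnt U i := lt_of_le_of_ne (h3 i) hne
    -- the largest non-element below
    have hex : ((Finset.Icc 1 i) \ B).Nonempty := by
      by_contra hemp
      rw [Finset.not_nonempty_iff_eq_empty, Finset.sdiff_eq_empty_iff_subset] at hemp
      have e1 := cnt_eq_add B 0 i (fun x hx1 hx2 => hemp (Finset.mem_Icc.mpr ⟨hx1, by omega⟩))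
      have e2 := cnt_le_add U 0 i
      have e3 : cnt U 0 = 0 := by simp [cnt]
      simp only [zero_add] at e1 e2
      omega
    set j := ((Finset.Icc 1 i) \ B).max' hex with hj
    have hjmem := Finset.max'_mem _ hex
    rw [← hj, Finset.mem_sdiff, Finset.mem_Icc] at hjmem
    obtain ⟨⟨hj1, hji⟩, hjB⟩ := hjmem
    have hjmax : ∀ x, j < x → x ≤ i → x ∈ B := by
      intro x hx1 hx2
      by_contra hxB
      have := Finset.le_max' ((Finset.Icc 1 i) \ B) x
        (Finset.mem_sdiff.mpr ⟨Finset.mem_Icc.mpr ⟨by omega, hx2⟩, hxB⟩)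
      omega
    refine hcirc.1 ⟨Finset.Icc 1 n \ insert j (B.erase (i + 1)), ?_, ?_⟩
    · refine Finset.mem_image.mpr ⟨_, ?_, rfl⟩
      rw [mem_bases hU hr]
      refine ⟨?_, ?_, ?_⟩
      · intro x hx
        rcases Finset.mem_insert.mp hx with rfl | hx
        · exact Finset.mem_Icc.mpr ⟨by omega, by omega⟩
        · exact h1 (Finset.mem_of_mem_erase hx)
      · rw [Finset.card_insert_of_notMem (by simp [hjB]), Finset.card_erase_of_mem hi]
        have := Finset.card_pos.mpr ⟨_, hi⟩
        omega
      · intro k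
        have h4 := cnt_swap hi hjB (by omega) hj1 k
        have h5 := h3 k
        by_cases hk : j ≤ k ∧ k ≤ i
        · obtain ⟨d, rfl⟩ := Nat.exists_eq_add_of_le hk.2
          have e1 := cnt_eq_add B k d (fun x hx1 hx2 => hjmax x (by omega) (by omega))
          have e2 := cnt_le_add U k d
          split_ifs at h4 <;> omega
        · split_ifs at h4 <;> omega
    · intro x hx
      have h7 := hmin x hx
      rcases Finset.mem_insert.mp (hC hx) with rfl | h8
      · refine Finset.mem_sdiff.mpr ⟨h1 hi, ?_⟩
        simp only [Finset.mem_insert, Finset.mem_erase]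
        rintro (h | h)
        · omega
        · exact h.1 rfl
      · rw [Finset.mem_sdiff] at h8 ⊢
        refine ⟨h8.1, ?_⟩
        simp only [Finset.mem_insert, Finset.mem_erase]
        rintro (h | h)
        · omega
        · exact h8.2 h.2
  · intro heq
    set D : Finset ℕ := insert (i + 1) ((Finset.Icc 1 n \ B).filter (fun x => i + 1 < x)) with hD
    have hdep : ¬ famIndep (famDual (Finset.Icc 1 n) (schubertBases n r U)) D := by
      rintro ⟨S, hS, hDS⟩
      obtain ⟨B', hB', rfl⟩ := Finset.mem_image.mp hS
      rw [mem_bases hU hr] at hB'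
      obtain ⟨g1, g2, g3⟩ := hB'
      have e1 := card_split B (i + 1) (fun x hx => (Finset.mem_Icc.mp (h1 hx)).1)
      have e2 := card_split B' i (fun x hx => (Finset.mem_Icc.mp (g1 hx)).1)
      have e3 : B'.filter (fun x => i < x) ⊆ B.filter (fun x => i + 1 < x) := by
        intro x hx
        rw [Finset.mem_filter] at hx ⊢
        have hxi : x ≠ i + 1 := by
          rintro rfl
          have := hDS (Finset.mem_insert_self _ _)
          exact (Finset.mem_sdiff.mp this).2 hx.1
        have hlt : i + 1 < x := by omega
        refine ⟨?_, hlt⟩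
        by_contra hxB
        have := hDS (Finset.mem_insert_of_mem (Finset.mem_filter.mpr
          ⟨Finset.mem_sdiff.mpr ⟨g1 hx.1, hxB⟩, hlt⟩))
        exact (Finset.mem_sdiff.mp this).2 hx.1
      have e4 := Finset.card_le_card e3
      have e5 := cnt_succ B i
      rw [if_pos hi] at e5
      have e6 := g3 i
      omega
    obtain ⟨C, hCD, hC⟩ := exists_circuit _ _ hdep
    refine ⟨hi, C, ?_, hC, ?_, ?_⟩
    · exact hCD.trans (Finset.insert_subset_insert _ (Finset.filter_subset _ _))
    · by_contra h7
      refine hC.1 ⟨Finset.Icc 1 n \ B, Finset.mem_image.mpr ⟨B, hB, rfl⟩, ?_⟩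
      exact ((Finset.subset_insert_iff_of_notMem h7).mp hCD).trans (Finset.filter_subset _ _)
    · intro x hx
      rcases Finset.mem_insert.mp (hCD hx) with rfl | h8
      · exact le_rfl
      · exact (Finset.mem_filter.mp h8).2.le

theorem intAct_zero_iff {n r : ℕ} {U : Finset ℕ} (hU : U ⊆ Finset.Icc 1 n) (hr : U.card = r)
    {B : Finset ℕ} (hB : B ∈ schubertBases n r U) :
    intAct (Finset.Icc 1 n) (schubertBases n r U) B = 0
      ↔ ∀ i, i + 1 ∈ B → cnt B i < cnt U i := by
  have hB' := (mem_bases hU hr _).mp hB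
  unfold intAct
  rw [Finset.card_eq_zero, Finset.filter_eq_empty_iff]
  constructor
  · intro h i hi
    have := h (hB'.1 hi)
    rw [intActive_iff hU hr hB i hi] at this
    exact lt_of_le_of_ne (hB'.2.2 i) this
  · intro h x hx hact
    have hxB := hact.1
    obtain ⟨i, rfl⟩ : ∃ i, x = i + 1 := ⟨x - 1, by have := Finset.mem_Icc.mp hx; omega⟩
    rw [intActive_iff hU hr hB i hxB] at hact
    exact absurd hact (h i hxB).ne

theorem alpha_eq {n r : ℕ} {U : Finset ℕ} (hU : U ⊆ Finset.Icc 1 n) (hr : U.card = r)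
    {B : Finset ℕ} (hB : B ∈ schubertBases n r U) (hne : B.Nonempty)
    (hi : intAct (Finset.Icc 1 n) (schubertBases n r U) B = 0)
    (he : extAct (Finset.Icc 1 n) (schubertBases n r U) B = 1) :
    alphaStat (Finset.Icc 1 n) (schubertBases n r U) B
      = (B.filter (fun i => 3 ≤ i ∧ i + 1 ≤ n ∧ i + 1 ∉ B)).card := by
  have hB' := (mem_bases hU hr _).mp hB
  have h12 := (extAct_one_iff hU hr hB hne).mp he
  have hint := (intAct_zero_iff hU hr hB).mp hi
  unfold alphaStat
  rw [hi, he]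
  congr 1
  refine Finset.filter_congr fun i hiB => ?_
  have hi1 := Finset.mem_Icc.mp (hB'.1 hiB)
  constructor
  · rintro ⟨g1, g2, -⟩
    have g1' := (mem_bases hU hr _).mp g1
    rw [extAct_one_iff hU hr g1 (Finset.insert_nonempty _ _)] at g2
    refine ⟨?_, ?_, ?_⟩
    · have n1 : i ≠ 1 := by rintro rfl; exact h12.1 hiB
      have n2 : i ≠ 2 := by
        rintro rfl
        simp at g2
      omega
    · exact (Finset.mem_Icc.mp (g1'.1 (Finset.mem_insert_self _ _))).2
    · intro hmem
      have := g1'.2.1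
      rw [Finset.insert_eq_of_mem (Finset.mem_erase.mpr ⟨by omega, hmem⟩),
        Finset.card_erase_of_mem hiB] at this
      have h5 := Finset.card_pos.mpr hne
      omega
  · rintro ⟨g1, g2, g3⟩
    have hb := swap_up hU hr hB hiB g3 (Nat.lt_succ_self i) g2
    refine ⟨hb, ?_, ?_⟩
    · rw [extAct_one_iff hU hr hb (Finset.insert_nonempty _ _)]
      simp only [Finset.mem_insert, Finset.mem_erase]
      refine ⟨?_, Or.inr ⟨by omega, h12.2⟩⟩
      rintro (h | h)
      · omega
      · exact h12.1 h.2
    · rw [intAct_zero_iff hU hr hb]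
      intro k hk
      have h4 := cnt_swap hiB g3 (by omega) (by omega) k
      rcases Finset.mem_insert.mp hk with h | h
      · have : k = i := by omega
        subst this
        have h5 := hB'.2.2 k
        simp at h4
        omega
      · have h5 := hint k (Finset.mem_of_mem_erase h)
        split_ifs at h4 <;> omega

/-! Words -/

noncomputable def stp (B : Finset ℕ) (k : ℕ) : DStep := if k ∈ B then DStep.north else DStep.east

/-- Word of `B` on positions `s, …, s+m-1`. -/
noncomputable def wrd (B : Finset ℕ) : ℕ → ℕ → List DStep
  | _, 0 => []
  | s, m + 1 => stp B s :: wrd B (s + 1) m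

theorem wrd_length (B : Finset ℕ) (s m : ℕ) : (wrd B s m).length = m := by
  induction m generalizing s with
  | zero => rfl
  | succ m ih => simp [wrd, ih]

theorem wrd_getD (B : Finset ℕ) (s m k : ℕ) (hk : k < m) :
    (wrd B s m).getD k DStep.east = stp B (s + k) := by
  induction m generalizing s k with
  | zero => omega
  | succ m ih =>
    cases k with
    | zero => simp [wrd]
    | succ k =>
      rw [wrd, List.getD_cons_succ, ih _ _ (by omega)]
      congr 1
      omega

def neCount : List DStep → ℕ
  | [] => 0
  | a :: l => (if a = DStep.north ∧ l.head? = some DStep.east then 1 else 0) + neCount l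

theorem neCount_wrd (B : Finset ℕ) (s m : ℕ) :
    neCount (wrd B s m)
      = (B.filter (fun i => s ≤ i ∧ i + 1 < s + m ∧ i + 1 ∉ B)).card := by
  induction m generalizing s with
  | zero =>
    symm
    rw [wrd, neCount, Finset.card_eq_zero, Finset.filter_eq_empty_iff]
    intro x _
    omega
  | succ m ih =>
    rw [wrd, neCount, ih]
    have key : (stp B s = DStep.north ∧ (wrd B (s + 1) m).head? = some DStep.east)
        ↔ (s ∈ B ∧ 0 < m ∧ s + 1 ∉ B) := by
      cases m with
      | zero => simp [wrd]
      | succ m => simp [wrd, stp]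
    rw [if_congr key rfl rfl]
    split_ifs with h
    · have : B.filter (fun i => s ≤ i ∧ i + 1 < s + (m + 1) ∧ i + 1 ∉ B)
        = insert s (B.filter (fun i => s + 1 ≤ i ∧ i + 1 < s + 1 + m ∧ i + 1 ∉ B)) := by
        ext x
        simp only [Finset.mem_filter, Finset.mem_insert]
        constructor
        · rintro ⟨a, b, c, d⟩
          by_cases hx : x = s
          · exact Or.inl hx
          · exact Or.inr ⟨a, by omega, by omega, d⟩
        · rintro (rfl | ⟨a, b, c, d⟩)
          · exact ⟨h.1, le_rfl, by omega, h.2.2⟩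
          · exact ⟨a, by omega, by omega, d⟩
      rw [this, Finset.card_insert_of_notMem (by simp), add_comm]
    · rw [zero_add]
      congr 1
      refine Finset.filter_congr fun x hx => ?_
      constructor
      · rintro ⟨a, b, c⟩
        exact ⟨by omega, by omega, c⟩
      · rintro ⟨a, b, c⟩
        have : x ≠ s := by
          rintro rfl
          exact h ⟨hx, by omega, c⟩
        exact ⟨by omega, by omega, c⟩

/-- Contractions of a word. -/
def contr (W : List DStep) (i : ℕ) : Set (List DStep) :=
  {P | (P.map expandNE).flatten = W ∧ diagCount P = i}

theorem cons_inj (a : DStep) : Function.Injective (fun l : List DStep => a :: l) :=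
  fun _ _ h => (List.cons.inj h).2

theorem diagCount_cons (a : DStep) (P : List DStep) :
    diagCount (a :: P) = diagCount P + (if a = DStep.diag then 1 else 0) := by
  unfold diagCount
  rw [List.filter_cons]
  by_cases h : a = DStep.diag <;> simp [h]

theorem contr_nil (i : ℕ) : (contr [] i).encard = Nat.choose 0 i := by
  have h : ∀ P : List DStep, (P.map expandNE).flatten = [] → P = [] := by
    intro P hP
    cases P with
    | nil => rfl
    | cons a P => cases a <;> simp [expandNE] at hP
  cases i with
  | zero =>
    have : contr [] 0 = {[]} := by
      ext P
      simp only [contr, Set.mem_ofPred_eq, Set.mem_singleton_iff]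
      constructor
      · exact fun hp => h P hp.1
      · rintro rfl
        exact ⟨rfl, rfl⟩
    rw [this]
    simp
  | succ i =>
    have : contr [] (i + 1) = ∅ := by
      ext P
      simp only [contr, Set.mem_ofPred_eq, Set.mem_empty_iff_false, iff_false]
      rintro ⟨h1, h2⟩
      rw [h P h1] at h2
      simp [diagCount] at h2
    rw [this]
    simp

theorem contr_east (W : List DStep) (i : ℕ) :
    contr (DStep.east :: W) i = (fun l => DStep.east :: l) '' contr W i := by
  ext P
  simp only [contr, Set.mem_ofPred_eq, Set.mem_image]
  constructor
  · rintro ⟨h1, h2⟩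
    cases P with
    | nil => simp at h1
    | cons a P =>
      cases a
      · simp [expandNE] at h1
        simp [diagCount_cons] at h2
        exact ⟨P, ⟨h1, h2⟩, rfl⟩
      · simp [expandNE] at h1
      · simp [expandNE] at h1
  · rintro ⟨P, ⟨h1, h2⟩, rfl⟩
    simp [expandNE, h1, diagCount_cons, h2]

theorem contr_north (W : List DStep) (i : ℕ) (hW : W.head? ≠ some DStep.east) :
    contr (DStep.north :: W) i = (fun l => DStep.north :: l) '' contr W i := by
  ext P
  simp only [contr, Set.mem_ofPred_eq, Set.mem_image]
  constructor
  · rintro ⟨h1, h2⟩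
    cases P with
    | nil => simp at h1
    | cons a P =>
      cases a
      · simp [expandNE] at h1
      · simp [expandNE] at h1
        simp [diagCount_cons] at h2
        exact ⟨P, ⟨h1, h2⟩, rfl⟩
      · simp [expandNE] at h1
        rw [← h1] at hW
        simp at hW
  · rintro ⟨P, ⟨h1, h2⟩, rfl⟩
    simp [expandNE, h1, diagCount_cons, h2]

theorem contr_ne_zero (W : List DStep) :
    contr (DStep.north :: DStep.east :: W) 0
      = (fun l => DStep.north :: l) '' contr (DStep.east :: W) 0 := by
  ext P
  simp only [contr, Set.mem_ofPred_eq, Set.mem_image]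
  constructor
  · rintro ⟨h1, h2⟩
    cases P with
    | nil => simp at h1
    | cons a P =>
      cases a
      · simp [expandNE] at h1
      · simp [expandNE] at h1
        simp [diagCount_cons] at h2
        exact ⟨P, ⟨h1, h2⟩, rfl⟩
      · simp [diagCount_cons] at h2
  · rintro ⟨P, ⟨h1, h2⟩, rfl⟩
    simp [expandNE, h1, diagCount_cons, h2]

theorem contr_ne_succ (W : List DStep) (i : ℕ) :
    contr (DStep.north :: DStep.east :: W) (i + 1)
      = (fun l => DStep.north :: l) '' contr (DStep.east :: W) (i + 1) ∪
        (fun l => DStep.diag :: l) '' contr W i := by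
  ext P
  simp only [contr, Set.mem_ofPred_eq, Set.mem_image, Set.mem_union]
  constructor
  · rintro ⟨h1, h2⟩
    cases P with
    | nil => simp at h1
    | cons a P =>
      cases a
      · simp [expandNE] at h1
      · simp [expandNE] at h1
        simp [diagCount_cons] at h2
        exact Or.inl ⟨P, ⟨h1, h2⟩, rfl⟩
      · simp [expandNE] at h1
        simp [diagCount_cons] at h2
        exact Or.inr ⟨P, ⟨h1, h2⟩, rfl⟩
  · rintro (⟨P, ⟨h1, h2⟩, rfl⟩ | ⟨P, ⟨h1, h2⟩, rfl⟩)
    · simp [expandNE, h1, diagCount_cons, h2]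
    · simp [expandNE, h1, diagCount_cons, h2]

theorem contr_card (W : List DStep) (hW : DStep.diag ∉ W) (i : ℕ) :
    (contr W i).encard = Nat.choose (neCount W) i := by
  induction hn : W.length using Nat.strong_induction_on generalizing W i with
  | _ n ih =>
    subst hn
    match W, hW, ih with
    | [], _, _ => exact contr_nil i
    | DStep.diag :: W, hW, _ => simp at hW
    | DStep.east :: W, hW, ih =>
      rw [contr_east, (cons_inj _).encard_image,
        ih _ (by simp) W (fun h => hW (List.mem_cons_of_mem _ h)) i rfl]
      simp [neCount]
    | DStep.north :: [], hW, ih =>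
      rw [contr_north _ _ (by simp), (cons_inj _).encard_image, contr_nil]
      simp [neCount]
    | DStep.north :: DStep.diag :: W, hW, ih => simp at hW
    | DStep.north :: DStep.north :: W, hW, ih =>
      rw [contr_north _ _ (by simp), (cons_inj _).encard_image,
        ih _ (by simp) (DStep.north :: W) (fun h => hW (List.mem_cons_of_mem _ h)) i rfl]
      simp [neCount]
    | DStep.north :: DStep.east :: W, hW, ih =>
      have hW' : DStep.diag ∉ W :=
        fun h => hW (List.mem_cons_of_mem _ (List.mem_cons_of_mem _ h))
      have hN : neCount (DStep.north :: DStep.east :: W) = neCount W + 1 := by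
        simp [neCount]; omega
      have hE : neCount (DStep.east :: W) = neCount W := by simp [neCount]
      cases i with
      | zero =>
        rw [contr_ne_zero, (cons_inj _).encard_image,
          ih _ (by simp) (DStep.east :: W) (fun h => hW (List.mem_cons_of_mem _ h)) 0 rfl]
        simp
      | succ i =>
        rw [contr_ne_succ, Set.encard_union_eq, (cons_inj _).encard_image,
          (cons_inj _).encard_image,
          ih _ (by simp) (DStep.east :: W) (fun h => hW (List.mem_cons_of_mem _ h)) (i + 1) rfl,
          ih _ (by simp) W hW' i rfl, hN, hE, Nat.choose_succ_succ]
        · push_cast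
          rw [add_comm]
        · rw [Set.disjoint_left]
          rintro P ⟨l, _, rfl⟩ ⟨l', _, h⟩
          simp at h

theorem diag_notMem_wrd (B : Finset ℕ) (s m : ℕ) : DStep.diag ∉ wrd B s m := by
  induction m generalizing s with
  | zero => simp [wrd]
  | succ m ih =>
    rw [wrd, List.mem_cons, not_or]
    refine ⟨?_, ih _⟩
    unfold stp
    split_ifs <;> simp

theorem diag_notMem_expand (P : List DStep) : DStep.diag ∉ (P.map expandNE).flatten := by
  induction P with
  | nil => simp
  | cons a P ih => cases a <;> simpa [expandNE] using ih

theorem mem_northSet (L : List DStep) (x : ℕ) :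
    x ∈ northSet L ↔ 1 ≤ x ∧ x ≤ L.length ∧ L.getD (x - 1) DStep.east = DStep.north := by
  unfold northSet
  simp only [Finset.mem_image, Finset.mem_filter, Finset.mem_range]
  constructor
  · rintro ⟨k, ⟨h1, h2⟩, rfl⟩
    exact ⟨by omega, by omega, by simpa using h2⟩
  · rintro ⟨h1, h2, h3⟩
    exact ⟨x - 1, ⟨by omega, h3⟩, by omega⟩

theorem northSet_wrd {n : ℕ} {B : Finset ℕ} (hB : B ⊆ Finset.Icc 1 n) :
    northSet (wrd B 1 n) = B := by
  ext x
  rw [mem_northSet, wrd_length]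
  constructor
  · rintro ⟨h1, h2, h3⟩
    rw [wrd_getD _ _ _ _ (by omega), show 1 + (x - 1) = x by omega] at h3
    by_contra h
    simp [stp, h] at h3
  · intro h
    have h1 := Finset.mem_Icc.mp (hB h)
    refine ⟨h1.1, h1.2, ?_⟩
    rw [wrd_getD _ _ _ _ (by omega), show 1 + (x - 1) = x by omega]
    simp [stp, h]

theorem eq_wrd {L : List DStep} (hL : DStep.diag ∉ L) :
    L = wrd (northSet L) 1 L.length := by
  refine List.ext_getElem (by rw [wrd_length]) ?_
  intro k h1 h2
  have e1 : (wrd (northSet L) 1 L.length)[k] =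
      (wrd (northSet L) 1 L.length).getD k DStep.east := by simp [h2]
  have e2 : L[k] = L.getD k DStep.east := by simp [h1]
  rw [e1, wrd_getD _ _ _ _ h1]
  unfold stp
  have h3 : (1 + k ∈ northSet L) ↔ L[k] = DStep.north := by
    rw [mem_northSet, e2, show 1 + k - 1 = k by omega]
    constructor
    · exact fun h => h.2.2
    · exact fun h => ⟨by omega, by omega, h⟩
  have h4 : L[k] ≠ DStep.diag := fun h => hL (h ▸ List.getElem_mem h1)
  split_ifs with h
  · exact h3.mp h
  · have h5 : L[k] ≠ DStep.north := fun h' => h (h3.mpr h')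
    cases h6 : L[k]
    · rfl
    · exact absurd h6 h5
    · exact absurd h6 h4

theorem expand_length (P : List DStep) :
    ((P.map expandNE).flatten).length = (P.map DStep.dx).sum + (P.map DStep.dy).sum := by
  induction P with
  | nil => rfl
  | cons a P ih =>
    cases a <;> simp only [List.map_cons, List.flatten_cons, List.length_append, ih,
      List.sum_cons, expandNE, DStep.dx, DStep.dy, List.length_cons, List.length_nil] <;> omega

theorem pathPos_zero (s : ℕ × ℕ) (P : List DStep) : pathPos s P 0 = s := by
  simp [pathPos]

theorem pathPos_cons (x y : ℕ) (a : DStep) (P : List DStep) (k : ℕ) :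
    pathPos (x, y) (a :: P) (k + 1) = pathPos (x + a.dx, y + a.dy) P k := by
  simp [pathPos, add_assoc]

theorem path_inv (B : Finset ℕ) (P : List DStep) (x y m : ℕ)
    (hP : (P.map expandNE).flatten = wrd B (x + y + 1) m) (hc : cnt B (x + y) = y) :
    (∀ k ≤ P.length, cnt B ((pathPos (x, y) P k).1 + (pathPos (x, y) P k).2)
        = (pathPos (x, y) P k).2) ∧
    (∀ (k : ℕ) (h : k < P.length), P.get ⟨k, h⟩ ≠ DStep.east →
      (pathPos (x, y) P k).1 + (pathPos (x, y) P k).2 + 1 ∈ B) := by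
  induction P generalizing x y m with
  | nil =>
    refine ⟨?_, fun k h => by simp at h⟩
    intro k hk
    have : k = 0 := by simpa using hk
    subst this
    rw [pathPos_zero]
    exact hc
  | cons a P ih =>
    have main : ∃ m', (P.map expandNE).flatten = wrd B ((x + a.dx) + (y + a.dy) + 1) m' ∧
        cnt B ((x + a.dx) + (y + a.dy)) = y + a.dy ∧
        (a ≠ DStep.east → x + y + 1 ∈ B) := by
      have hs := cnt_succ B (x + y)
      cases a with
      | east =>
        cases m with
        | zero => simp [expandNE, wrd] at hP
        | succ m =>
          simp only [List.map_cons, expandNE, List.flatten_cons, wrd, List.cons_append,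
            List.nil_append, List.cons.injEq] at hP
          have hnB : x + y + 1 ∉ B := fun h => by simp [stp, h] at hP
          refine ⟨m, ?_, ?_, fun h => absurd rfl h⟩
          · rw [hP.2]; congr 1; simp [DStep.dx, DStep.dy]; omega
          · rw [if_neg hnB] at hs
            simp only [DStep.dx, DStep.dy]
            rw [show x + 1 + (y + 0) = x + y + 1 by omega]
            omega
      | north =>
        cases m with
        | zero => simp [expandNE, wrd] at hP
        | succ m =>
          simp only [List.map_cons, expandNE, List.flatten_cons, wrd, List.cons_append,
            List.nil_append, List.cons.injEq] at hP
          have hnB : x + y + 1 ∈ B := by by_contra h; simp [stp, h] at hP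
          refine ⟨m, ?_, ?_, fun _ => hnB⟩
          · rw [hP.2]; congr 1
          · rw [if_pos hnB] at hs
            simp only [DStep.dx, DStep.dy]
            rw [show x + 0 + (y + 1) = x + y + 1 by omega]
            omega
      | diag =>
        match m with
        | 0 => simp [expandNE, wrd] at hP
        | 1 => simp [expandNE, wrd] at hP
        | m + 2 =>
          simp only [List.map_cons, expandNE, List.flatten_cons, wrd, List.cons_append,
            List.nil_append, List.cons.injEq] at hP
          have hnB : x + y + 1 ∈ B := by by_contra h; simp [stp, h] at hP
          have hnB' : x + y + 1 + 1 ∉ B := fun h => by simp [stp, h] at hP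
          have hs' := cnt_succ B (x + y + 1)
          refine ⟨m, ?_, ?_, fun _ => hnB⟩
          · rw [hP.2.2]; congr 1; simp [DStep.dx, DStep.dy]; omega
          · rw [if_pos hnB] at hs
            rw [if_neg hnB'] at hs'
            simp only [DStep.dx, DStep.dy]
            rw [show x + 1 + (y + 1) = x + y + 1 + 1 by omega]
            omega
    obtain ⟨m', h1, h2, h3⟩ := main
    obtain ⟨i1, i2⟩ := ih _ _ _ h1 h2
    constructor
    · intro k hk
      cases k with
      | zero => rw [pathPos_zero]; exact hc
      | succ k =>
        rw [pathPos_cons]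
        exact i1 k (by simpa using hk)
    · intro k hk hne
      cases k with
      | zero => rw [pathPos_zero]; exact h3 hne
      | succ k =>
        rw [pathPos_cons]
        exact i2 k (by simpa using hk) hne

theorem set_eq {n r : ℕ} {U : Finset ℕ} (hU : U ⊆ Finset.Icc 1 n) (hr : U.card = r)
    {B : Finset ℕ} (hB : B ∈ schubertBases n r U) 
    (hint : ∀ i, i + 1 ∈ B → cnt B i < cnt U i) (h1B : 1 ∉ B) (h2B : 2 ∈ B) (i : ℕ) :
    {P : List DStep | IsAdmissible n r U P ∧ delannoyBasis P = B ∧ diagCount P = i}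
      = contr (wrd B 3 (n - 2)) i := by
  obtain ⟨hsub, hcard, hle⟩ := (mem_bases hU hr _).mp hB
  have hn2 : 2 ≤ n := (Finset.mem_Icc.mp (hsub h2B)).2
  have hrn : r ≤ n := by
    have := Finset.card_le_card hsub
    rw [hcard] at this
    simpa using this
  have hc2 : cnt B 2 = 1 := by
    have e1 := cnt_succ B 0
    have e2 := cnt_succ B 1
    have e3 : cnt B 0 = 0 := by simp [cnt]
    simp [h1B] at e1
    simp [h2B] at e2
    omega
  have hword : wrd B 1 n = DStep.east :: DStep.north :: wrd B 3 (n - 2) := by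
    obtain ⟨m, rfl⟩ := Nat.exists_eq_add_of_le hn2
    rw [show 2 + m = m + 1 + 1 by omega, wrd, wrd]
    simp [stp, h1B, h2B]
  ext P
  simp only [Set.mem_ofPred_eq, contr]
  constructor
  · rintro ⟨hadm, hbas, hd⟩
    refine ⟨?_, hd⟩
    have hend := hadm.1.1
    simp only [pathPos, List.take_length, Prod.mk.injEq] at hend
    have hlen : (fullPath P).length = n := by
      unfold fullPath
      rw [List.length_cons, List.length_cons, expand_length]
      omega
    have hdn : DStep.diag ∉ fullPath P := by
      unfold fullPath
      simp only [List.mem_cons, not_or]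
      exact ⟨by simp, by simp, diag_notMem_expand P⟩
    have := eq_wrd hdn
    rw [hlen, show northSet (fullPath P) = B from hbas, hword] at this
    unfold fullPath at this
    simpa using this
  · rintro ⟨hP, hd⟩
    have hfull : fullPath P = wrd B 1 n := by
      rw [hword, ← hP]
      rfl
    obtain ⟨i1, i2⟩ := path_inv B P 1 1 (n - 2) hP hc2
    have hlen := expand_length P
    rw [hP, wrd_length] at hlen
    refine ⟨⟨⟨?_, ?_⟩, ?_⟩, ?_, hd⟩
    · have e1 := i1 P.length le_rfl
      simp only [pathPos, List.take_length] at e1 ⊢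
      rw [cnt_top' hsub (by omega), hcard] at e1
      rw [Prod.mk.injEq]
      omega
    · intro k hk
      have e1 := i1 k hk
      unfold belowPath
      exact (e1.symm.le).trans (hle _)
    · intro k hk
      have e1 := i1 k hk.le
      have e2 := i2 k hk
      have key : P.get ⟨k, hk⟩ ≠ DStep.east →
          ¬ uVertSeg U (pathPos (1, 1) P k).1 (pathPos (1, 1) P k).2 := by
        intro hne
        have h3 := hint _ (e2 hne)
        rintro ⟨g1, g2⟩
        have g3 := cnt_succ U ((pathPos (1, 1) P k).1 + (pathPos (1, 1) P k).2)
        rw [if_pos g1] at g3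
        change cnt U _ = _ at g2
        omega
      refine ⟨fun h => Or.inr (key (by rw [h]; simp)), fun h => ?_⟩
      have hne : P.get ⟨k, hk⟩ ≠ DStep.east := by rw [h]; simp
      refine ⟨?_, key hne⟩
      have g3 := cnt_succ B ((pathPos (1, 1) P k).1 + (pathPos (1, 1) P k).2)
      rw [if_pos (e2 hne), e1] at g3
      unfold belowPath
      change _ ≤ cnt U _
      rw [← add_assoc]
      exact g3.symm.le.trans (hle _)
    · unfold delannoyBasis
      rw [hfull, northSet_wrd hsub]


/-- Let `SM(U)` be a loopless and coloopless Schubert matroid on `[n]`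
of rank `r` and let `B` be a basis with `i(B) = 0` and `e(B) = 1`. For every `i ≥ 0`,
the number of admissible Delannoy paths `P` associated to `SM(U)` with `B_P = B` and
exactly `i` diagonal steps equals `C(α(B), i)`. -/
theorem statement3 (n r : ℕ) (U : Finset ℕ) (hUsub : U ⊆ Finset.Icc 1 n)
    (hUcard : U.card = r)
    (hloopless : ∀ e ∈ Finset.Icc 1 n, ∃ B ∈ schubertBases n r U, e ∈ B)
    (hcoloopless : ∀ e ∈ Finset.Icc 1 n, ∃ B ∈ schubertBases n r U, e ∉ B)
    (B : Finset ℕ) (hB : B ∈ schubertBases n r U)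
    (hiB : intAct (Finset.Icc 1 n) (schubertBases n r U) B = 0)
    (heB : extAct (Finset.Icc 1 n) (schubertBases n r U) B = 1)
    (i : ℕ) :
    {P : List DStep | IsAdmissible n r U P ∧ delannoyBasis P = B ∧ diagCount P = i}.ncard
      = Nat.choose (alphaStat (Finset.Icc 1 n) (schubertBases n r U) B) i := by
  have hne : B.Nonempty := by
    rw [Finset.nonempty_iff_ne_empty]
    rintro rfl
    have hc := ((mem_bases hUsub hUcard _).mp hB).2.1
    unfold extAct at heB
    obtain ⟨a, ha⟩ := Finset.card_eq_one.mp heB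
    have ha' := (Finset.mem_filter.mp (ha ▸ Finset.mem_singleton_self a)).1
    obtain ⟨B', hB', hmem⟩ := hloopless a ha'
    have hc' := ((mem_bases hUsub hUcard _).mp hB').2.1
    have := Finset.card_pos.mpr ⟨a, hmem⟩
    rw [Finset.card_empty] at hc
    omega
  have hint := (intAct_zero_iff hUsub hUcard hB).mp hiB
  obtain ⟨h1B, h2B⟩ := (extAct_one_iff hUsub hUcard hB hne).mp heB
  have hn2 : 2 ≤ n :=
    (Finset.mem_Icc.mp (((mem_bases hUsub hUcard _).mp hB).1 h2B)).2
  rw [set_eq hUsub hUcard hB hint h1B h2B i, alpha_eq hUsub hUcard hB hne hiB heB,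
    Set.ncard_def, contr_card _ (diag_notMem_wrd _ _ _), neCount_wrd, ENat.toNat_natCast]
  congr 2
  refine Finset.filter_congr fun x _ => ?_
  constructor
  · rintro ⟨a, b, c⟩
    exact ⟨a, by omega, c⟩
  · rintro ⟨a, b, c⟩
    exact ⟨a, by omega, c⟩
end GPoly
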